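/- arXiv:2108.04422 — 2 statements merged into one kernel-verified Lean document; each statement's English description precedes it below -/
import Mathlib

section
/- (Theorem: Waterfall is D-competitive) For every MLAPD instance of depth D, the cost of the schedule produced by the Waterfall algorithm is at most D times the cost of every feasible schedule of the instance. -/
open Classical

variable {V : Type} [Fintype V] [DecidableEq V] {Req : Type} [Fintype Req]

/-- The root path of `v`: the set of nodes of the form `par^[n] v`, i.e. `v` and its ancestors. -/
noncomputable def rootPath (par : V → V) (v : V) : Finset V :=
  Finset.univ.filter (fun u => ∃ n : ℕ, par^[n] v = u)

/-- The level of a node: the cardinality of its root path (the root has level 1). -/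
noncomputable def level (par : V → V) (v : V) : ℕ :=
  (rootPath par v).card

/-- The depth `D` of the instance: the maximum level over all nodes. -/
noncomputable def depth (par : V → V) : ℕ :=
  Finset.univ.sup (level par)

/-- A valid service tree: contains the root and is closed under the parent map. -/
def IsServiceTree (r : V) (par : V → V) (S : Finset V) : Prop :=
  r ∈ S ∧ ∀ u ∈ S, par u ∈ S

/-- A service `(S, t)` satisfies a request `ρ` if the node of `ρ` lies in `S`
and `t` lies in the time window `[arr ρ, dl ρ]`. -/
def SatisfiedBy (node : Req → V) (arr dl : Req → ℝ) (S : Finset V) (t : ℝ) (ρ : Req) : Prop :=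
  node ρ ∈ S ∧ arr ρ ≤ t ∧ t ≤ dl ρ

/-- The cost of a service subtree. -/
noncomputable def serviceCost (c : V → ℝ) (S : Finset V) : ℝ :=
  ∑ u ∈ S, c u

/-- The cost of a schedule: the sum of the costs of its services. -/
noncomputable def scheduleCost (c : V → ℝ) (sched : List (Finset V × ℝ)) : ℝ :=
  (sched.map fun s => serviceCost c s.1).sum

/-- A schedule is feasible if each of its members is a valid service and every
request is satisfied by some service of the schedule. -/
def Feasible (r : V) (par : V → V) (node : Req → V) (arr dl : Req → ℝ)
    (sched : List (Finset V × ℝ)) : Prop :=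
  (∀ s ∈ sched, IsServiceTree r par s.1) ∧
  ∀ ρ : Req, ∃ s ∈ sched, SatisfiedBy node arr dl s.1 s.2 ρ

/-- The list of all requests, sorted in increasing order of deadline. -/
noncomputable def sortedReqs (dl : Req → ℝ) : List Req :=
  (Finset.univ : Finset Req).toList.mergeSort (fun a b => decide (dl a ≤ dl b))

/-- The set of nodes on the path in the subtree `T_v` from `v` down to the node `x`
(assuming `x ∈ T_v`): the ancestors of `x` that lie in `T_v`. -/
noncomputable def pathFromTo (par : V → V) (v x : V) : Finset V :=
  (rootPath par x).filter (fun u => v ∈ rootPath par u)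

/-- A `v`-fall at time `t`.  The state consists of the tentative service tree `S`,
the current prices `p`, the remaining budget `b` (initially `c v`), and the set `added`
of nodes added so far by this fall.  Requests are scanned in increasing deadline order;
a request `γ` is considered when it is active at time `t` (it has arrived and is not
satisfied by any service in `prior`), is issued in the subtree `T_v`, and is not
satisfied by the tentative service `(S, t)`.  If the total price of the missing part
`P(v → γ | S)` of the path from `v` to `γ` exceeds the remaining budget, the prices of
these overflow nodes are scaled down by the factor `1 - b / p(v → γ | S)` and the fall
ends; otherwise the missing nodes are added to `S` (their prices being reset to their
costs), the budget decreases by their total price, and the scan continues. -/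
noncomputable def fallAux (par : V → V) (c : V → ℝ) (node : Req → V) (arr dl : Req → ℝ)
    (prior : List (Finset V × ℝ)) (v : V) (t : ℝ) :
    List Req → Finset V → (V → ℝ) → ℝ → Finset V → Finset V × (V → ℝ) × Finset V
  | [], S, p, _, added => (S, p, added)
  | γ :: rest, S, p, b, added =>
    if arr γ ≤ t ∧ (∀ s ∈ prior, ¬ SatisfiedBy node arr dl s.1 s.2 γ) ∧
        v ∈ rootPath par (node γ) ∧ ¬ SatisfiedBy node arr dl S t γ then
      if b < ∑ u ∈ pathFromTo par v (node γ) \ S, p u then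
        (S,
          (fun u => if u ∈ pathFromTo par v (node γ) \ S then
              p u * (1 - b / ∑ w ∈ pathFromTo par v (node γ) \ S, p w)
            else p u),
          added)
      else
        fallAux par c node arr dl prior v t rest (S ∪ (pathFromTo par v (node γ) \ S))
          (fun u => if u ∈ pathFromTo par v (node γ) \ S then c u else p u)
          (b - ∑ u ∈ pathFromTo par v (node γ) \ S, p u)
          (added ∪ (pathFromTo par v (node γ) \ S))
    else
      fallAux par c node arr dl prior v t rest S p b added

/-- Processing of the FIFO queue of the Waterfall algorithm at time `t`: while the queue
is nonempty, dequeue a node `v`, perform a `v`-fall with budget `c v`, and enqueue the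
nodes added by the fall.  The fuel argument bounds the number of iterations; since every
node is enqueued at most once, a fuel of `2 * |V| + 1` suffices for the loop to run
to completion. -/
noncomputable def queueAux (par : V → V) (c : V → ℝ) (node : Req → V) (arr dl : Req → ℝ)
    (prior : List (Finset V × ℝ)) (t : ℝ) :
    ℕ → List V → Finset V → (V → ℝ) → Finset V × (V → ℝ)
  | 0, _, S, p => (S, p)
  | _ + 1, [], S, p => (S, p)
  | fuel + 1, v :: Q, S, p =>
    let res := fallAux par c node arr dl prior v t (sortedReqs dl) S p (c v) ∅
    queueAux par c node arr dl prior t fuel (Q ++ res.2.2.toList) res.1 res.2.1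

/-- The Waterfall algorithm: prices are initialized to the costs, and requests are
processed in increasing deadline order; when the deadline of a request `ρ` not satisfied
by any earlier Waterfall service is reached, a service is started from the root path
`P(v(ρ))` (whose prices are reset to the costs), the nodes of `P(v(ρ))` are enqueued,
the queue is processed by falls, and the resulting tree is transmitted at time `d(ρ)`. -/
noncomputable def waterfallAux (par : V → V) (c : V → ℝ) (node : Req → V) (arr dl : Req → ℝ) :
    List Req → List (Finset V × ℝ) → (V → ℝ) → List (Finset V × ℝ)
  | [], acc, _ => acc
  | ρ :: rest, acc, p =>
    if ∃ s ∈ acc, SatisfiedBy node arr dl s.1 s.2 ρ then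
      waterfallAux par c node arr dl rest acc p
    else
      let res := queueAux par c node arr dl acc (dl ρ) (2 * Fintype.card V + 1)
        (rootPath par (node ρ)).toList (rootPath par (node ρ))
        (fun u => if u ∈ rootPath par (node ρ) then c u else p u)
      waterfallAux par c node arr dl rest (acc ++ [(res.1, dl ρ)]) res.2

/-- The schedule produced by the Waterfall algorithm. -/
noncomputable def waterfall (par : V → V) (c : V → ℝ) (node : Req → V) (arr dl : Req → ℝ) :
    List (Finset V × ℝ) :=
  waterfallAux par c node arr dl (sortedReqs dl) [] c

set_option linter.unusedSectionVars false

section tree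

theorem wf_mem_rp (par : V → V) (u v : V) : u ∈ rootPath par v ↔ ∃ n : ℕ, par^[n] v = u := by
  simp [rootPath]

theorem wf_rp_self (par : V → V) (v : V) : v ∈ rootPath par v :=
  (wf_mem_rp par v v).2 ⟨0, rfl⟩

theorem wf_rp_trans (par : V → V) {u v w : V} (h1 : u ∈ rootPath par v)
    (h2 : v ∈ rootPath par w) : u ∈ rootPath par w := by
  rw [wf_mem_rp] at *
  obtain ⟨a, rfl⟩ := h1
  obtain ⟨b, rfl⟩ := h2
  exact ⟨a + b, by rw [Function.iterate_add_apply]⟩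

theorem wf_rp_par (par : V → V) {u v : V} (h1 : u ∈ rootPath par v) :
    par u ∈ rootPath par v := by
  rw [wf_mem_rp] at *
  obtain ⟨a, rfl⟩ := h1
  exact ⟨a + 1, by rw [Function.iterate_succ_apply']⟩

theorem wf_rp_par' (par : V → V) {u v : V} (h1 : v ∈ rootPath par u) (hne : u ≠ v) :
    v ∈ rootPath par (par u) := by
  rw [wf_mem_rp] at *
  obtain ⟨a, rfl⟩ := h1
  cases a with
  | zero => simp at hne
  | succ a => exact ⟨a, by rw [Function.iterate_succ_apply]⟩

theorem wf_closed (par : V → V) {S : Finset V} (hS : ∀ u ∈ S, par u ∈ S) {u v : V}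
    (hv : v ∈ S) (hu : u ∈ rootPath par v) : u ∈ S := by
  rw [wf_mem_rp] at hu
  obtain ⟨a, rfl⟩ := hu
  induction a with
  | zero => simpa using hv
  | succ a ih => rw [Function.iterate_succ_apply']; exact hS _ ih

theorem wf_antisymm (r : V) (par : V → V) (hroot : par r = r)
    (hreach : ∀ v : V, ∃ n : ℕ, par^[n] v = r) {v w : V} (h1 : v ∈ rootPath par w)
    (h2 : w ∈ rootPath par v) : v = w := by
  rw [wf_mem_rp] at *
  obtain ⟨b, hb⟩ := h1
  obtain ⟨a, ha⟩ := h2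
  rcases Nat.eq_zero_or_pos b with h0 | hpos
  · subst h0; simpa using hb.symm
  have hr : ∀ k, par^[k] r = r := fun k => Function.iterate_fixed hroot k
  have hcyc : par^[a + b] w = w := by rw [Function.iterate_add_apply, hb, ha]
  obtain ⟨n, hn⟩ := hreach w
  have hk : par^[(a + b) * n] w = w := by
    rw [Function.iterate_mul]; exact Function.iterate_fixed hcyc n
  have hle : n ≤ (a + b) * n := Nat.le_mul_of_pos_left n (by omega)
  obtain ⟨m, hm⟩ := Nat.exists_eq_add_of_le' hle
  rw [hm, Function.iterate_add_apply, hn, hr] at hk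
  rw [← hb, ← hk, hr]

theorem wf_level_lt (r : V) (par : V → V) (hroot : par r = r)
    (hreach : ∀ v : V, ∃ n : ℕ, par^[n] v = r) {v w : V} (h1 : v ∈ rootPath par w)
    (hne : w ≠ v) : level par v + 1 ≤ level par w := by
  apply Finset.card_lt_card
  rw [Finset.ssubset_iff_of_subset (fun x hx => wf_rp_trans par hx h1)]
  exact ⟨w, wf_rp_self par w, fun h => hne (wf_antisymm r par hroot hreach h1 h).symm⟩

theorem wf_level_le (par : V → V) (v : V) : level par v ≤ depth par :=
  Finset.le_sup (f := level par) (Finset.mem_univ v)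

end tree

/-- a request that has arrived by `t` and is unsatisfied by `prior` -/
def WfAct (node : Req → V) (arr dl : Req → ℝ) (prior : List (Finset V × ℝ)) (t : ℝ)
    (γ : Req) : Prop :=
  arr γ ≤ t ∧ ∀ s ∈ prior, ¬ SatisfiedBy node arr dl s.1 s.2 γ

theorem wf_fall (par : V → V) (c : V → ℝ) (node : Req → V) (arr dl : Req → ℝ)
    (hc : ∀ v, 0 < c v)
    (prior : List (Finset V × ℝ)) (v : V) (t : ℝ) :
    ∀ (L : List Req) (S : Finset V) (p : V → ℝ) (b : ℝ) (added : Finset V),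
      L.Pairwise (fun x y => dl x ≤ dl y) → v ∈ S → (∀ u ∈ S, par u ∈ S) → (∀ u, 0 < p u) →
      0 ≤ b →
      ∃ (S' : Finset V) (p' : V → ℝ) (J : V → ℝ),
        fallAux par c node arr dl prior v t L S p b added = (S', p', added ∪ (S' \ S)) ∧
        S ⊆ S' ∧ (∀ u ∈ S', par u ∈ S') ∧ (∀ u, 0 < p' u) ∧ (∀ w, 0 ≤ J w) ∧
        (∀ w ∈ S, J w = 0 ∧ p' w = p w) ∧
        (∀ w ∈ S', w ∉ S → J w = p w ∧ p' w = c w) ∧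
        (∀ w, w ∉ S' → p' w = p w - J w) ∧
        (∀ w, J w ≠ 0 → v ∈ rootPath par w ∧ ∃ γ, WfAct node arr dl prior t γ ∧
          w ∈ rootPath par (node γ) ∧ ∀ γ0 ∈ L, WfAct node arr dl prior t γ0 →
            v ∈ rootPath par (node γ0) → node γ0 ∉ S' → dl γ ≤ dl γ0) ∧
        (∑ w, J w ≤ b) ∧
        (∀ γ0 ∈ L, WfAct node arr dl prior t γ0 →
            v ∈ rootPath par (node γ0) → node γ0 ∉ S' → ∑ w, J w = b) := by
  intro L
  induction L with
  | nil =>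
    intro S p b added _ hv hS hp hb
    refine ⟨S, p, fun _ => 0, by simp [fallAux], subset_rfl, hS, hp, by simp, by simp, ?_, by simp,
      by simp, by simpa using hb, by simp⟩
    intro w h1 h2; exact absurd h1 h2
  | cons γ rest ih =>
    intro S p b added hL hv hS hp hb
    rw [List.pairwise_cons] at hL
    obtain ⟨hL1, hL2⟩ := hL
    by_cases hcond : arr γ ≤ t ∧ (∀ s ∈ prior, ¬ SatisfiedBy node arr dl s.1 s.2 γ) ∧
        v ∈ rootPath par (node γ) ∧ ¬ SatisfiedBy node arr dl S t γ
    · have hγact : WfAct node arr dl prior t γ := ⟨hcond.1, hcond.2.1⟩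
      have hvγ := hcond.2.2.1
      have hpath : ∀ u, u ∈ pathFromTo par v (node γ) \ S ↔
          (u ∈ rootPath par (node γ) ∧ v ∈ rootPath par u) ∧ u ∉ S := by
        intro u; simp [pathFromTo]
      set X := pathFromTo par v (node γ) \ S with hX
      by_cases hov : b < ∑ u ∈ X, p u
      · have hpos : 0 < ∑ u ∈ X, p u := lt_of_le_of_lt hb hov
        refine ⟨S, fun u => if u ∈ X then p u * (1 - b / ∑ w ∈ X, p w) else p u,
          fun u => if u ∈ X then p u * (b / ∑ w ∈ X, p w) else 0, ?_, subset_rfl, hS, ?_, ?_,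
          ?_, ?_, ?_, ?_, ?_, ?_⟩
        · rw [fallAux, if_pos hcond, if_pos hov, Finset.sdiff_self, Finset.union_empty]
        · intro u
          have : b / ∑ w ∈ X, p w < 1 := by rw [div_lt_one hpos]; exact hov
          dsimp only
          split_ifs
          · exact mul_pos (hp u) (by linarith)
          · exact hp u
        · intro u
          dsimp only
          split_ifs
          · exact mul_nonneg (hp u).le (div_nonneg hb hpos.le)
          · exact le_rfl
        · intro w hw
          have : w ∉ X := fun h => ((hpath w).1 h).2 hw
          simp [this]
        · intro w h1 h2; exact absurd h1 h2
        · intro w hw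
          dsimp only
          split_ifs
          · ring
          · ring
        · intro w hw
          have hwX : w ∈ X := by
            by_contra h; simp [h] at hw
          have := (hpath w).1 hwX
          refine ⟨this.1.2, γ, hγact, this.1.1, ?_⟩
          intro γ0 h0 _ _ _
          rcases List.mem_cons.1 h0 with rfl | h0
          · exact le_rfl
          · exact hL1 _ h0
        · rw [Finset.sum_ite_mem, Finset.univ_inter, ← Finset.sum_mul]
          rw [mul_div_cancel₀ _ hpos.ne']
        · intro _ _ _ _ _
          rw [Finset.sum_ite_mem, Finset.univ_inter, ← Finset.sum_mul]
          rw [mul_div_cancel₀ _ hpos.ne']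
      · have hclosed : ∀ u ∈ S ∪ X, par u ∈ S ∪ X := by
          intro u hu
          by_cases hpu : par u ∈ S
          · exact Finset.mem_union_left _ hpu
          rcases Finset.mem_union.1 hu with hu | hu
          · exact absurd (hS u hu) hpu
          · have h := (hpath u).1 hu
            refine Finset.mem_union_right _ ((hpath _).2 ⟨⟨wf_rp_par par h.1.1, ?_⟩, hpu⟩)
            apply wf_rp_par' par h.1.2
            rintro rfl; exact h.2 hv
        have hnodeγ : node γ ∈ S ∪ X := by
          by_cases h : node γ ∈ S
          · exact Finset.mem_union_left _ h
          · exact Finset.mem_union_right _ ((hpath _).2 ⟨⟨wf_rp_self par _, hvγ⟩, h⟩)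
        obtain ⟨S', p', J, h1, h2, h3, h4, h5, h6, h7, h8, h9, h10, h11⟩ :=
          ih (S ∪ X) (fun u => if u ∈ X then c u else p u) (b - ∑ u ∈ X, p u) (added ∪ X)
            hL2 (Finset.mem_union_left _ hv) hclosed
            (by intro u; split_ifs; exacts [hc u, hp u])
            (by linarith)
        have hXS : ∀ w ∈ X, w ∉ S := fun w hw => ((hpath w).1 hw).2
        have hsum : ∑ w, (J w + if w ∈ X then p w else 0) = ∑ w, J w + ∑ u ∈ X, p u := by
          rw [Finset.sum_add_distrib, Finset.sum_ite_mem, Finset.univ_inter]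
        refine ⟨S', p', fun w => J w + if w ∈ X then p w else 0, ?_,
          Finset.union_subset_left h2, h3, h4, ?_, ?_, ?_, ?_, ?_, ?_, ?_⟩
        · rw [fallAux, if_pos hcond, if_neg hov, h1]
          congr 2
          ext w
          have := @h2 w
          have := hXS w
          simp only [Finset.mem_union, Finset.mem_sdiff] at *
          tauto
        · intro w
          have := h5 w
          dsimp only
          split_ifs
          · linarith [hp w]
          · linarith
        · intro w hw
          have hwX : w ∉ X := fun h => hXS w h hw
          have := h6 w (Finset.mem_union_left _ hw)
          simpa [hwX] using this
        · intro w hw hwS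
          by_cases hwX : w ∈ X
          · have := h6 w (Finset.mem_union_right _ hwX)
            simpa [hwX] using this
          · have := h7 w hw (by simp [hwX, hwS])
            simpa [hwX] using this
        · intro w hw
          have hwX : w ∉ X := fun h => hw (h2 (Finset.mem_union_right _ h))
          have := h8 w hw
          simpa [hwX] using this
        · intro w hw
          by_cases hwX : w ∈ X
          · have := (hpath w).1 hwX
            refine ⟨this.1.2, γ, hγact, this.1.1, ?_⟩
            intro γ0 h0 _ _ _
            rcases List.mem_cons.1 h0 with rfl | h0
            · exact le_rfl
            · exact hL1 _ h0
          · obtain ⟨hA, γ', hB, hC, hD⟩ := h9 w (by simpa [hwX] using hw)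
            refine ⟨hA, γ', hB, hC, ?_⟩
            intro γ0 h0 ha hb hn
            rcases List.mem_cons.1 h0 with rfl | h0
            · exact absurd (h2 hnodeγ) hn
            · exact hD _ h0 ha hb hn
        · rw [hsum]; linarith
        · intro γ0 h0 ha hb hn
          rcases List.mem_cons.1 h0 with rfl | h0
          · exact absurd (h2 hnodeγ) hn
          · rw [hsum, h11 _ h0 ha hb hn]; ring
    · obtain ⟨S', p', J, h1, h2, h3, h4, h5, h6, h7, h8, h9, h10, h11⟩ :=
        ih S p b added hL2 hv hS hp hb
      have hkey : WfAct node arr dl prior t γ → v ∈ rootPath par (node γ) → node γ ∈ S' := by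
        intro ha hb
        by_contra hn
        apply hcond
        refine ⟨ha.1, ha.2, hb, fun h => hn (h2 h.1)⟩
      refine ⟨S', p', J, ?_, h2, h3, h4, h5, h6, h7, h8, ?_, h10, ?_⟩
      · rw [fallAux, if_neg hcond, h1]
      · intro w hw
        obtain ⟨hA, γ', hB, hC, hD⟩ := h9 w hw
        refine ⟨hA, γ', hB, hC, ?_⟩
        intro γ0 h0 ha hb hn
        rcases List.mem_cons.1 h0 with rfl | h0
        · exact absurd (hkey ha hb) hn
        · exact hD _ h0 ha hb hn
      · intro γ0 h0 ha hb hn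
        rcases List.mem_cons.1 h0 with rfl | h0
        · exact absurd (hkey ha hb) hn
        · exact h11 _ h0 ha hb hn

theorem wf_sorted_mem (dl : Req → ℝ) (γ : Req) : γ ∈ sortedReqs dl := by
  simp [sortedReqs]

theorem wf_sorted_pw (dl : Req → ℝ) : (sortedReqs dl).Pairwise (fun x y => dl x ≤ dl y) := by
  have := List.pairwise_mergeSort (le := fun a b : Req => decide (dl a ≤ dl b))
    (by intro a b c; simp; exact le_trans) (by intro a b; simp; exact le_total _ _)
    (Finset.univ : Finset Req).toList
  simpa [sortedReqs] using this

theorem wf_sorted_nodup (dl : Req → ℝ) : (sortedReqs dl).Nodup := by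
  unfold sortedReqs
  exact (List.mergeSort_perm _ _).nodup_iff.2 (Finset.nodup_toList _)

/-- What one service of the algorithm does. -/
def WfStep (par : V → V) (c : V → ℝ) (node : Req → V) (A : Req → Prop) (dl : Req → ℝ)
    (Q : V → Prop) (S0 : Finset V) (p : V → ℝ) (S' : Finset V) (p' : V → ℝ)
    (I : V → V → ℝ) : Prop :=
  S0 ⊆ S' ∧ (∀ u ∈ S', par u ∈ S') ∧ (∀ u, 0 < p' u) ∧ (∀ v w, 0 ≤ I v w) ∧
  (∀ v w, I v w ≠ 0 → Q v ∨ (v ∈ S' ∧ v ∉ S0)) ∧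
  (∀ w ∈ S0, (∀ v, I v w = 0) ∧ p' w = p w) ∧
  (∀ w ∈ S', w ∉ S0 → ∑ v, I v w = p w ∧ p' w = c w) ∧
  (∀ w, w ∉ S' → p' w = p w - ∑ v, I v w) ∧
  (∀ v w, I v w ≠ 0 → v ∈ rootPath par w ∧ w ≠ v ∧ ∃ γ, A γ ∧
    w ∈ rootPath par (node γ) ∧ ∀ γ0, A γ0 →
      v ∈ rootPath par (node γ0) → node γ0 ∉ S' → dl γ ≤ dl γ0) ∧
  (∀ v, ∑ w, I v w ≤ c v) ∧
  (∀ v, (Q v ∨ (v ∈ S' ∧ v ∉ S0)) → ∀ γ0, A γ0 →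
    v ∈ rootPath par (node γ0) → node γ0 ∉ S' → ∑ w, I v w = c v)

theorem wf_queue (par : V → V) (c : V → ℝ) (node : Req → V) (arr dl : Req → ℝ)
    (hc : ∀ v, 0 < c v) (prior : List (Finset V × ℝ)) (t : ℝ) :
    ∀ (fuel : ℕ) (Q : List V) (S : Finset V) (p : V → ℝ),
      Q.Nodup → (∀ v ∈ Q, v ∈ S) → (∀ u ∈ S, par u ∈ S) → (∀ u, 0 < p u) →
      Q.length + (Finset.univ \ S).card ≤ fuel →
      ∃ (S' : Finset V) (p' : V → ℝ) (I : V → V → ℝ),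
        queueAux par c node arr dl prior t fuel Q S p = (S', p') ∧
        WfStep par c node (WfAct node arr dl prior t) dl (fun v => v ∈ Q) S p S' p' I := by
  have base : ∀ (S : Finset V) (p : V → ℝ), (∀ u ∈ S, par u ∈ S) → (∀ u, 0 < p u) →
      WfStep par c node (WfAct node arr dl prior t) dl (fun v => v ∈ ([] : List V)) S p S p
        (fun _ _ => 0) := by
    intro S p hS hp
    refine ⟨subset_rfl, hS, hp, by simp, by simp, by simp, ?_, by simp, by simp, ?_, ?_⟩
    · intro w h1 h2; exact absurd h1 h2
    · intro v; simpa using (hc v).le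
    · intro v h; simp at h
  intro fuel
  induction fuel with
  | zero =>
    intro Q S p hnd hQ hS hp hf
    have : Q = [] := List.eq_nil_of_length_eq_zero (by omega)
    subst this
    exact ⟨S, p, _, by simp [queueAux], base S p hS hp⟩
  | succ fuel ih =>
    intro Q S p hnd hQ hS hp hf
    cases Q with
    | nil => exact ⟨S, p, _, by simp [queueAux], base S p hS hp⟩
    | cons v Q =>
      rw [List.nodup_cons] at hnd
      have hv : v ∈ S := hQ v (by simp)
      obtain ⟨S1, p1, J, f1, f2, f3, f4, f5, f6, f7, f8, f9, f10, f11⟩ :=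
        wf_fall par c node arr dl hc prior v t (sortedReqs dl) S p (c v) ∅ (wf_sorted_pw dl)
          hv hS hp (hc v).le
      have hcard : (S1 \ S).card + (Finset.univ \ S1).card = (Finset.univ \ S).card := by
        rw [← Finset.card_union_of_disjoint]
        · congr 1
          ext x
          have := @f2 x
          simp only [Finset.mem_union, Finset.mem_sdiff, Finset.mem_univ, true_and]
          tauto
        · rw [Finset.disjoint_left]
          intro x hx hx'
          simp only [Finset.mem_sdiff] at hx hx'
          exact hx'.2 hx.1
      obtain ⟨S', p', I, g1, g2, g3, g4, g5, g5', g6, g7, g8, g9, g10, g11⟩ :=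
        ih (Q ++ (S1 \ S).toList) S1 p1
          (by
            rw [List.nodup_append]
            refine ⟨hnd.2, Finset.nodup_toList _, ?_⟩
            intro a ha b hb hab
            subst hab
            rw [Finset.mem_toList, Finset.mem_sdiff] at hb
            exact hb.2 (hQ a (by simp [ha])))
          (by
            intro a ha
            rcases List.mem_append.1 ha with ha | ha
            · exact f2 (hQ a (by simp [ha]))
            · rw [Finset.mem_toList, Finset.mem_sdiff] at ha
              exact ha.1)
          f3 f4
          (by
            simp only [List.length_append, Finset.length_toList, List.length_cons] at hf ⊢
            omega)
      have hQ1 : ∀ u, (u ∈ Q ++ (S1 \ S).toList ∨ (u ∈ S' ∧ u ∉ S1)) ↔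
          (u ∈ Q ∨ (u ∈ S' ∧ u ∉ S)) := by
        intro u
        have a1 := @f2 u
        have a2 := @g2 u
        have a3 := hQ u
        simp only [List.mem_append, Finset.mem_toList, Finset.mem_sdiff, List.mem_cons] at *
        tauto
      have hIv : ∀ w, I v w = 0 := by
        intro w
        by_contra h
        have := (hQ1 v).1 (g5' v w h)
        rcases this with h | h
        · exact hnd.1 h
        · exact h.2 hv
      have hcol : ∀ w, ∑ u, (I u w + if u = v then J w else 0) = ∑ u, I u w + J w := by
        intro w
        rw [Finset.sum_add_distrib]; simp
      have hrow : ∀ u, ∑ w, (I u w + if u = v then J w else 0) =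
          if u = v then ∑ w, J w else ∑ w, I u w := by
        intro u
        split_ifs with h
        · subst h; simp [hIv]
        · simp
      have hne : ∀ u w, (I u w + if u = v then J w else 0) ≠ 0 →
          (u = v ∧ J w ≠ 0) ∨ (u ≠ v ∧ I u w ≠ 0) := by
        intro u w h
        by_cases huv : u = v
        · subst huv; left; simpa [hIv] using h
        · right; simpa [huv] using h
      refine ⟨S', p', fun u w => I u w + if u = v then J w else 0, ?_, f2.trans g2, g3, g4, ?_, ?_,
        ?_, ?_, ?_, ?_, ?_, ?_⟩
      · rw [queueAux, f1]
        simpa using g1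
      · intro u w
        have := g5 u w
        have := f5 w
        dsimp only
        split_ifs <;> linarith
      · intro u w h
        rcases hne u w h with ⟨h, _⟩ | ⟨_, h⟩
        · left; simp [h]
        · rcases (hQ1 u).1 (g5' u w h) with h | h
          · left; simp [h]
          · right; exact h
      · intro w hw
        have a := g6 w (f2 hw)
        have b := f6 w hw
        refine ⟨fun u => ?_, ?_⟩
        · simp [a.1 u, b.1]
        · rw [a.2, b.2]
      · intro w hw hwS
        rw [hcol]
        by_cases h : w ∈ S1
        · have a := g6 w h
          have b := f7 w h hwS
          refine ⟨?_, ?_⟩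
          · simp [a.1, b.1]
          · rw [a.2, b.2]
        · have a := g7 w hw h
          have b := f8 w h
          refine ⟨?_, a.2⟩
          linarith [a.1]
      · intro w hw
        rw [hcol]
        have h : w ∉ S1 := fun h => hw (g2 h)
        have a := g8 w hw
        have b := f8 w h
        linarith
      · intro u w h
        rcases hne u w h with ⟨rfl, hj⟩ | ⟨_, hj⟩
        · obtain ⟨a, γ, b, d, e⟩ := f9 w hj
          refine ⟨a, ?_, γ, b, d, ?_⟩
          · rintro rfl; exact hj (f6 _ hv).1
          · intro γ0 h1 h2 h3
            exact e γ0 (wf_sorted_mem dl γ0) h1 h2 (fun h => h3 (g2 h))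
        · exact g9 u w hj
      · intro u
        rw [hrow]
        split_ifs with h
        · subst h; exact f10
        · exact g10 u
      · intro u hu γ0 h1 h2 h3
        rw [hrow]
        split_ifs with h
        · subst h
          exact f11 γ0 (wf_sorted_mem dl γ0) h1 h2 (fun h => h3 (g2 h))
        · apply g11 u _ γ0 h1 h2 h3
          rw [hQ1]
          simpa [h] using hu

/-- One complete service at time `t` with trigger `ρ`. -/
def WfService (par : V → V) (c : V → ℝ) (node : Req → V) (A : Req → Prop) (dl : Req → ℝ) (t : ℝ)
    (p : V → ℝ) (S : Finset V) (p' : V → ℝ) (I : V → V → ℝ) : Prop :=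
  (∃ ρ, A ρ ∧ dl ρ = t ∧ ∀ w ∈ S, w ∈ rootPath par (node ρ) ∨ ∑ v, I v w = p w) ∧
  (∀ u ∈ S, par u ∈ S) ∧ (∀ u, 0 < p' u) ∧ (∀ v w, 0 ≤ I v w) ∧
  (∀ v w, v ∉ S → I v w = 0) ∧
  (∀ w ∈ S, ∑ v, I v w ≤ p w ∧ p' w = c w) ∧
  (∀ w, w ∉ S → p' w = p w - ∑ v, I v w) ∧
  (∀ v w, I v w ≠ 0 → v ∈ rootPath par w ∧ w ≠ v ∧ ∃ γ, A γ ∧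
    w ∈ rootPath par (node γ) ∧ ∀ γ0, A γ0 →
      v ∈ rootPath par (node γ0) → node γ0 ∉ S → dl γ ≤ dl γ0) ∧
  (∀ v, ∑ w, I v w ≤ c v) ∧
  (∀ v ∈ S, ∀ γ0, A γ0 →
    v ∈ rootPath par (node γ0) → node γ0 ∉ S → ∑ w, I v w = c v)

theorem wf_service (par : V → V) (c : V → ℝ) (node : Req → V) (arr dl : Req → ℝ)
    (hc : ∀ v, 0 < c v) (prior : List (Finset V × ℝ)) (ρ : Req) (p : V → ℝ) (hp : ∀ u, 0 < p u)
    (hρ : WfAct node arr dl prior (dl ρ) ρ) :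
    ∃ (S : Finset V) (p' : V → ℝ) (I : V → V → ℝ),
      queueAux par c node arr dl prior (dl ρ) (2 * Fintype.card V + 1)
        (rootPath par (node ρ)).toList (rootPath par (node ρ))
        (fun u => if u ∈ rootPath par (node ρ) then c u else p u) = (S, p') ∧
      node ρ ∈ S ∧
      WfService par c node (WfAct node arr dl prior (dl ρ)) dl (dl ρ) p S p' I := by
  obtain ⟨S', p', I, g1, g2, g3, g4, g5, g5', g6, g7, g8, g9, g10, g11⟩ :=
    wf_queue par c node arr dl hc prior (dl ρ) (2 * Fintype.card V + 1)
        (rootPath par (node ρ)).toList (rootPath par (node ρ))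
        (fun u => if u ∈ rootPath par (node ρ) then c u else p u)
        (Finset.nodup_toList _) (by simp) (fun u hu => wf_rp_par par hu)
        (by intro u; split_ifs; exacts [hc u, hp u])
        (by
          have h1 := Finset.card_le_univ (rootPath par (node ρ))
          have h2 := Finset.card_le_univ (Finset.univ \ rootPath par (node ρ))
          simp only [Finset.length_toList]
          omega)
  have hQ : ∀ v, (v ∈ (rootPath par (node ρ)).toList ∨ (v ∈ S' ∧ v ∉ rootPath par (node ρ))) ↔
      v ∈ S' := by
    intro v
    have := @g2 v
    rw [Finset.mem_toList]
    tauto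
  refine ⟨S', p', I, g1, g2 (wf_rp_self _ _), ⟨ρ, hρ, rfl, ?_⟩, g3, g4, g5, ?_, ?_, ?_, g9, g10, ?_⟩
  · intro w hw
    by_cases h : w ∈ rootPath par (node ρ)
    · exact Or.inl h
    · right
      have := (g7 w hw h).1
      simpa [h] using this
  · intro v w hv
    by_contra h
    exact hv ((hQ v).1 (g5' v w h))
  · intro w hw
    by_cases h : w ∈ rootPath par (node ρ)
    · have := g6 w h
      refine ⟨?_, by simpa [h] using this.2⟩
      simp [this.1, (hp w).le]
    · have := g7 w hw h
      refine ⟨?_, this.2⟩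
      have := this.1
      simp only [h, if_false] at this
      exact this.le
  · intro w hw
    have h : w ∉ rootPath par (node ρ) := fun h => hw (g2 h)
    have := g8 w hw
    simpa [h] using this
  · intro v hv
    exact g11 v ((hQ v).2 hv)

/-- A run of `n` services of the algorithm. -/
def WfTrace (par : V → V) (c : V → ℝ) (node : Req → V) (arr dl : Req → ℝ) (n : ℕ)
    (F : ℕ → Finset V × ℝ) (P : ℕ → V → ℝ) (I : ℕ → V → V → ℝ) : Prop :=
  P 0 = c ∧
  (∀ i < n, WfService par c node (WfAct node arr dl ((List.range i).map F) (F i).2) dl (F i).2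
    (P i) (F i).1 (P (i + 1)) (I i)) ∧
  (∀ j < n, ∀ i < j, (F i).2 < (F j).2) ∧
  (∀ i < n, ∀ γ, WfAct node arr dl ((List.range i).map F) (F i).2 γ → (F i).2 ≤ dl γ)

theorem wf_run (par : V → V) (c : V → ℝ) (node : Req → V) (arr dl : Req → ℝ)
    (hc : ∀ v, 0 < c v) (harr : ∀ ρ, arr ρ ≤ dl ρ) :
    ∀ (rest : List Req) (n : ℕ) (F : ℕ → Finset V × ℝ) (P : ℕ → V → ℝ) (I : ℕ → V → V → ℝ),
      rest.Pairwise (fun x y => dl x < dl y) → WfTrace par c node arr dl n F P I →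
      (∀ u, 0 < P n u) → (∀ i < n, ∀ γ ∈ rest, (F i).2 < dl γ) →
      (∀ γ, γ ∈ rest ∨ ∃ i < n, SatisfiedBy node arr dl (F i).1 (F i).2 γ) →
      ∃ (n' : ℕ) (F' : ℕ → Finset V × ℝ) (P' : ℕ → V → ℝ) (I' : ℕ → V → V → ℝ),
        waterfallAux par c node arr dl rest ((List.range n).map F) (P n) = (List.range n').map F' ∧
        WfTrace par c node arr dl n' F' P' I' ∧
        (∀ γ, ∃ i < n', SatisfiedBy node arr dl (F' i).1 (F' i).2 γ) := by
  intro rest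
  induction rest with
  | nil =>
    intro n F P I _ hT _ _ hs
    exact ⟨n, F, P, I, by simp [waterfallAux], hT, by simpa using hs⟩
  | cons ρ rest ih =>
    intro n F P I hpw hT hp hlt hs
    rw [List.pairwise_cons] at hpw
    by_cases hsat : ∃ s ∈ (List.range n).map F, SatisfiedBy node arr dl s.1 s.2 ρ
    · rw [waterfallAux, if_pos hsat]
      apply ih n F P I hpw.2 hT hp (fun i hi γ hγ => hlt i hi γ (by simp [hγ]))
      intro γ
      rcases hs γ with h | h
      · rcases List.mem_cons.1 h with rfl | h
        · right
          simpa using hsat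
        · exact Or.inl h
      · exact Or.inr h
    · have hρ : WfAct node arr dl ((List.range n).map F) (dl ρ) ρ :=
        ⟨harr ρ, fun s hs h => hsat ⟨s, hs, h⟩⟩
      obtain ⟨S, p', J, h1, h2, h3⟩ :=
        wf_service par c node arr dl hc ((List.range n).map F) ρ (P n) hp hρ
      rw [waterfallAux, if_neg hsat, h1]
      set F' : ℕ → Finset V × ℝ := fun i => if i < n then F i else (S, dl ρ) with hF'
      set P' : ℕ → V → ℝ := fun i => if i < n + 1 then P i else p' with hP'
      set I' : ℕ → V → V → ℝ := fun i => if i < n then I i else J with hI'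
      have eF : ∀ i, i < n → F' i = F i := fun i hi => by simp [hF', hi]
      have eFn : F' n = (S, dl ρ) := by simp [hF']
      have eP : ∀ i, i ≤ n → P' i = P i := fun i hi => by
        simp only [hP']; rw [if_pos (by omega)]
      have ePn : P' (n + 1) = p' := by simp [hP']
      have eI : ∀ i, i < n → I' i = I i := fun i hi => by simp [hI', hi]
      have eIn : I' n = J := by simp [hI']
      have eR : ∀ i, i ≤ n → (List.range i).map F' = (List.range i).map F := by
        intro i hi
        apply List.map_congr_left
        intro k hk
        rw [List.mem_range] at hk
        exact eF k (by omega)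
      have eRn : (List.range n).map F ++ [(S, dl ρ)] = (List.range (n + 1)).map F' := by
        rw [List.range_succ, List.map_append, eR n le_rfl]
        simp [eFn]
      dsimp only
      rw [eRn, ← ePn]
      apply ih (n + 1) F' P' I' hpw.2
      · obtain ⟨t1, t2, t3, t4⟩ := hT
        refine ⟨by rw [eP 0 (by omega), t1], ?_, ?_, ?_⟩
        · intro i hi
          rcases Nat.lt_succ_iff_lt_or_eq.1 hi with hi | rfl
          · rw [eR i hi.le, eF i hi, eP i hi.le, eP (i + 1) hi, eI i hi]
            exact t2 i hi
          · rw [eR i le_rfl, eFn, eP i le_rfl, ePn, eIn]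
            exact h3
        · intro j hj i hij
          rcases Nat.lt_succ_iff_lt_or_eq.1 hj with hj | rfl
          · rw [eF j hj, eF i (by omega)]
            exact t3 j hj i hij
          · rw [eFn, eF i hij]
            exact hlt i hij ρ (by simp)
        · intro i hi γ
          rcases Nat.lt_succ_iff_lt_or_eq.1 hi with hi | rfl
          · rw [eR i hi.le, eF i hi]
            exact t4 i hi γ
          · rw [eR i le_rfl, eFn]
            intro hγ
            rcases hs γ with h | ⟨k, hk, h⟩
            · rcases List.mem_cons.1 h with rfl | h
              · exact le_rfl
              · exact (hpw.1 γ h).le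
            · exact absurd h (hγ.2 (F k) (List.mem_map.2 ⟨k, List.mem_range.2 hk, rfl⟩))
      · rw [ePn]; exact h3.2.2.1
      · intro i hi γ hγ
        rcases Nat.lt_succ_iff_lt_or_eq.1 hi with hi | rfl
        · rw [eF i hi]; exact hlt i hi γ (by simp [hγ])
        · rw [eFn]; exact hpw.1 γ hγ
      · intro γ
        rcases hs γ with h | ⟨k, hk, h⟩
        · rcases List.mem_cons.1 h with rfl | h
          · right
            exact ⟨n, by omega, by rw [eFn]; exact ⟨h2, harr _, le_rfl⟩⟩
          · exact Or.inl h
        · right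
          exact ⟨k, by omega, by rw [eF k hk]; exact h⟩

theorem wf_trace (par : V → V) (c : V → ℝ) (node : Req → V) (arr dl : Req → ℝ)
    (hc : ∀ v, 0 < c v) (harr : ∀ ρ, arr ρ ≤ dl ρ) (hdl : Function.Injective dl) :
    ∃ (n : ℕ) (F : ℕ → Finset V × ℝ) (P : ℕ → V → ℝ) (I : ℕ → V → V → ℝ),
      waterfall par c node arr dl = (List.range n).map F ∧
      WfTrace par c node arr dl n F P I ∧
      (∀ γ, ∃ i < n, SatisfiedBy node arr dl (F i).1 (F i).2 γ) := by
  have hpw : (sortedReqs dl).Pairwise (fun x y => dl x < dl y) := by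
    have := (wf_sorted_pw dl).and (wf_sorted_nodup dl)
    apply this.imp
    intro a b h
    exact lt_of_le_of_ne h.1 (fun e => h.2 (hdl e))
  have := wf_run par c node arr dl hc harr (sortedReqs dl) 0 (fun _ => (∅, 0)) (fun _ => c)
    (fun _ _ _ => 0) hpw ⟨rfl, by simp, by simp, by simp⟩ hc (by simp)
    (fun γ => Or.inl (wf_sorted_mem dl γ))
  simpa [waterfall] using this

section abstract_part

variable {K : Type} [Fintype K]

/-- `j` is the first index `≥ i` with `w ∈ S j`. -/
def WfPer (S : ℕ → Finset V) (w : V) (i j : ℕ) : Prop :=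
  i ≤ j ∧ w ∈ S j ∧ ∀ k, i ≤ k → k < j → w ∉ S k

theorem wf_per_unique (S : ℕ → Finset V) (w : V) (i j j' : ℕ) (h : WfPer S w i j)
    (h' : WfPer S w i j') : j = j' := by
  rcases lt_trichotomy j j' with hl | hl | hl
  · exact absurd h.2.1 (h'.2.2 j h.1 hl)
  · exact hl
  · exact absurd h'.2.1 (h.2.2 j' h'.1 hl)

theorem wf_price (n : ℕ) (c : V → ℝ) (S : ℕ → Finset V) (P : ℕ → V → ℝ) (I : ℕ → V → V → ℝ)
    (h0 : P 0 = c) (h1 : ∀ i < n, ∀ w ∈ S i, P (i + 1) w = c w)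
    (h2 : ∀ i < n, ∀ w, w ∉ S i → P (i + 1) w = P i w - ∑ v, I i v w) (w : V) :
    ∀ j ≤ n, ∑ i ∈ (Finset.range j).filter (fun i => ∀ k, i ≤ k → k < j → w ∉ S k),
      ∑ v, I i v w = c w - P j w := by
  intro j
  induction j with
  | zero => simp [h0]
  | succ j ih =>
    intro hj
    by_cases hw : w ∈ S j
    · rw [h1 j (by omega) w hw, sub_self]
      apply Finset.sum_eq_zero
      intro i hi
      rw [Finset.mem_filter, Finset.mem_range] at hi
      exact absurd hw (hi.2 j (by omega) (by omega))
    · have : (Finset.range (j + 1)).filter (fun i => ∀ k, i ≤ k → k < j + 1 → w ∉ S k) =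
          insert j ((Finset.range j).filter (fun i => ∀ k, i ≤ k → k < j → w ∉ S k)) := by
        ext i
        simp only [Finset.mem_filter, Finset.mem_range, Finset.mem_insert]
        constructor
        · rintro ⟨a, b⟩
          by_cases hij : i = j
          · exact Or.inl hij
          · exact Or.inr ⟨by omega, fun k hk hk' => b k hk (by omega)⟩
        · rintro (rfl | ⟨a, b⟩)
          · refine ⟨by omega, fun k hk hk' => ?_⟩
            have : k = i := by omega
            rw [this]; exact hw
          · refine ⟨by omega, fun k hk hk' => ?_⟩
            by_cases hkj : k = j
            · rw [hkj]; exact hw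
            · exact b k hk (by omega)
      rw [this, Finset.sum_insert (by simp), ih (by omega), h2 j (by omega) w hw]
      ring

theorem wf_price' (n : ℕ) (c : V → ℝ) (S : ℕ → Finset V) (P : ℕ → V → ℝ) (I : ℕ → V → V → ℝ)
    (h0 : P 0 = c) (h1 : ∀ i < n, ∀ w ∈ S i, P (i + 1) w = c w)
    (h2 : ∀ i < n, ∀ w, w ∉ S i → P (i + 1) w = P i w - ∑ v, I i v w) (w : V)
    (j : ℕ) (hj : j < n) (hw : w ∈ S j) :
    ∑ i ∈ (Finset.range n).filter (fun i => WfPer S w i j), ∑ v, I i v w =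
      c w - P j w + ∑ v, I j v w := by
  have : (Finset.range n).filter (fun i => WfPer S w i j) =
      insert j ((Finset.range j).filter (fun i => ∀ k, i ≤ k → k < j → w ∉ S k)) := by
    ext i
    simp only [Finset.mem_filter, Finset.mem_range, Finset.mem_insert]
    constructor
    · rintro ⟨a, b, d, e⟩
      by_cases hij : i = j
      · exact Or.inl hij
      · exact Or.inr ⟨by omega, e⟩
    · rintro (rfl | ⟨a, b⟩)
      · exact ⟨hj, le_rfl, hw, fun k hk hk' => by omega⟩
      · exact ⟨by omega, by omega, hw, b⟩
  rw [this, Finset.sum_insert (by simp), wf_price n c S P I h0 h1 h2 w j hj.le]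
  ring

theorem wf_swap (n : ℕ) (S : ℕ → Finset V) (I : ℕ → V → V → ℝ) (C : ℕ × V → Prop) (g : V → ℝ) :
    ∑ z ∈ Finset.range n ×ˢ (Finset.univ : Finset V), ∑ y ∈ Finset.range n ×ˢ (Finset.univ : Finset V),
      (if C y ∧ WfPer S y.2 z.1 y.1 then g y.2 * I z.1 z.2 y.2 else 0) =
    ∑ y ∈ (Finset.range n ×ˢ (Finset.univ : Finset V)).filter C, g y.2 *
      ∑ i ∈ (Finset.range n).filter (fun i => WfPer S y.2 i y.1), ∑ v, I i v y.2 := by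
  rw [Finset.sum_comm, Finset.sum_filter]
  apply Finset.sum_congr rfl
  intro y _
  by_cases hC : C y
  · simp only [hC, true_and, if_true]
    rw [Finset.sum_product, Finset.sum_filter, Finset.mul_sum]
    apply Finset.sum_congr rfl
    intro i _
    by_cases hP : WfPer S y.2 i y.1
    · simp only [hP, if_true, Finset.mul_sum]
    · simp [hP]
  · simp [hC]

theorem wf_inj (O : K → Finset V) (X : Finset (ℕ × V)) (f : ℕ × V → K) (g : V → ℝ)
    (hg : ∀ v, 0 ≤ g v) (hf : ∀ x ∈ X, x.2 ∈ O (f x))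
    (hinj : ∀ x ∈ X, ∀ y ∈ X, x.2 = y.2 → f x = f y → x = y) :
    ∑ x ∈ X, g x.2 ≤ ∑ k, ∑ v ∈ O k, g v := by
  have h1 : ∑ x ∈ X, g x.2 = ∑ z ∈ X.image (fun x => (f x, x.2)), g z.2 := by
    rw [Finset.sum_image]
    intro x hx y hy hxy
    simp only [Prod.mk.injEq] at hxy
    exact hinj x hx y hy hxy.2 hxy.1
  have h2 : ∑ k, ∑ v ∈ O k, g v =
      ∑ z ∈ ((Finset.univ : Finset K) ×ˢ (Finset.univ : Finset V)).filter (fun z => z.2 ∈ O z.1),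
        g z.2 := by
    rw [Finset.sum_filter, Finset.sum_product]
    apply Finset.sum_congr rfl
    intro k _
    dsimp only
    rw [Finset.sum_ite_mem, Finset.univ_inter]
  rw [h1, h2]
  apply Finset.sum_le_sum_of_subset_of_nonneg
  · intro z hz
    rw [Finset.mem_image] at hz
    obtain ⟨x, hx, rfl⟩ := hz
    simpa using hf x hx
  · intro z _ _; exact hg _

theorem wf_abstract (r : V) (par : V → V) (c : V → ℝ) (node : Req → V) (arr dl : Req → ℝ)
    (hroot : par r = r) (hreach : ∀ v : V, ∃ n : ℕ, par^[n] v = r)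
    (hc : ∀ v, 0 < c v)
    (n : ℕ) (S : ℕ → Finset V) (T : ℕ → ℝ) (P : ℕ → V → ℝ) (I : ℕ → V → V → ℝ)
    (Act : ℕ → Req → Prop)
    (hAct : ∀ i γ, Act i γ ↔ arr γ ≤ T i ∧ ∀ k < i, ¬ SatisfiedBy node arr dl (S k) (T k) γ)
    (hsteps : ∀ i < n, WfService par c node (Act i) dl (T i) (P i) (S i) (P (i + 1)) (I i))
    (hP0 : P 0 = c) (hT : ∀ j < n, ∀ i < j, T i < T j)
    (hActdl : ∀ i < n, ∀ γ, Act i γ → T i ≤ dl γ)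
    (hall : ∀ γ, ∃ i < n, SatisfiedBy node arr dl (S i) (T i) γ)
    (O : K → Finset V) (o : K → ℝ) (hO : ∀ k, ∀ u ∈ O k, par u ∈ O k)
    (hfeas : ∀ γ, ∃ k, SatisfiedBy node arr dl (O k) (o k) γ) :
    ∑ i ∈ Finset.range n, ∑ v ∈ S i, c v ≤ (depth par : ℝ) * ∑ k, ∑ v ∈ O k, c v := by
  have hPpos : ∀ i ≤ n, ∀ w, 0 < P i w := by
    intro i hi w
    cases i with
    | zero => rw [hP0]; exact hc w
    | succ i => exact (hsteps i hi).2.2.1 w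
  have hScl : ∀ i < n, ∀ v w, w ∈ S i → v ∈ rootPath par w → v ∈ S i :=
    fun i hi v w hw hv => wf_closed par (hsteps i hi).2.1 hw hv
  have hOcl : ∀ k, ∀ v w, w ∈ O k → v ∈ rootPath par w → v ∈ O k :=
    fun k v w hw hv => wf_closed par (hO k) hw hv
  have hInn : ∀ i < n, ∀ v w, 0 ≤ I i v w := fun i hi => (hsteps i hi).2.2.2.1
  have hI0 : ∀ i < n, ∀ v w, v ∉ S i → I i v w = 0 := fun i hi => (hsteps i hi).2.2.2.2.1
  have hcol : ∀ i < n, ∀ w ∈ S i, ∑ v, I i v w ≤ P i w ∧ P (i + 1) w = c w :=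
    fun i hi => (hsteps i hi).2.2.2.2.2.1
  have hcol' : ∀ i < n, ∀ w, w ∉ S i → P (i + 1) w = P i w - ∑ v, I i v w :=
    fun i hi => (hsteps i hi).2.2.2.2.2.2.1
  have hinv : ∀ i < n, ∀ v w, I i v w ≠ 0 → v ∈ rootPath par w ∧ w ≠ v ∧ ∃ γ, Act i γ ∧
    w ∈ rootPath par (node γ) ∧ ∀ γ0, Act i γ0 →
      v ∈ rootPath par (node γ0) → node γ0 ∉ S i → dl γ ≤ dl γ0 :=
    fun i hi => (hsteps i hi).2.2.2.2.2.2.2.1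
  have hrow : ∀ i < n, ∀ v, ∑ w, I i v w ≤ c v := fun i hi => (hsteps i hi).2.2.2.2.2.2.2.2.1
  have hrow' : ∀ i < n, ∀ v ∈ S i, ∀ γ0, Act i γ0 →
      v ∈ rootPath par (node γ0) → node γ0 ∉ S i → ∑ w, I i v w = c v :=
    fun i hi => (hsteps i hi).2.2.2.2.2.2.2.2.2
  have hTle : ∀ j < n, ∀ i ≤ j, T i ≤ T j := by
    intro j hj i hij
    rcases Nat.lt_or_eq_of_le hij with h | h
    · exact (hT j hj i h).le
    · rw [h]
  -- activity persists until served
  have hpersist : ∀ i j, j < n → ∀ w γ, Act i γ → w ∈ rootPath par (node γ) → WfPer S w i j →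
      Act j γ := by
    intro i j hj w γ ha hw hper
    rw [hAct] at ha ⊢
    refine ⟨ha.1.trans (hTle j hj i hper.1), fun k hk hs => ?_⟩
    by_cases hki : k < i
    · exact ha.2 k hki hs
    · exact hper.2.2 k (by omega) hk (hScl k (by omega) _ _ hs.1 hw)
  have hnext : ∀ i < n, ∀ w γ, Act i γ → w ∈ rootPath par (node γ) → ∃ j < n, WfPer S w i j := by
    intro i hi w γ ha hw
    obtain ⟨k, hk, hs⟩ := hall γ
    have hik : i ≤ k := by
      by_contra h
      exact ((hAct i γ).1 ha).2 k (by omega) hs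
    have hex : ∃ j, i ≤ j ∧ w ∈ S j := ⟨k, hik, hScl k hk _ _ hs.1 hw⟩
    refine ⟨Nat.find hex, lt_of_le_of_lt (Nat.find_min' hex ⟨hik, hScl k hk _ _ hs.1 hw⟩) hk,
      (Nat.find_spec hex).1, (Nat.find_spec hex).2, ?_⟩
    intro l hl hl' hw'
    exact Nat.find_min hex hl' ⟨hl, hw'⟩
  -- overdue pairs
  let Ov : ℕ × V → Prop := fun x => x.2 ∈ S x.1 ∧ ∃ γ, Act x.1 γ ∧ x.2 ∈ rootPath par (node γ) ∧
    ∀ k, x.2 ∈ O k → T x.1 < o k → o k ≤ dl γ → False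
  -- the key lemma
  have hX : ∀ i < n, ∀ v ∈ S i, ∀ γ0, Act i γ0 → v ∈ rootPath par (node γ0) → node γ0 ∉ S i →
      (∀ k, v ∈ O k → T i < o k → o k ≤ dl γ0 → False) →
      ∀ w, I i v w ≠ 0 → ∀ j < n, WfPer S w i j → Ov (j, w) := by
    intro i hi v hv γ0 ha0 hv0 hn0 hno w hw j hj hper
    obtain ⟨hvw, _, γ, ha, hwγ, hd⟩ := hinv i hi v w hw
    refine ⟨hper.2.1, γ, hpersist i j hj w γ ha hwγ hper, hwγ, ?_⟩
    intro k hk h1 h2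
    exact hno k (hOcl k _ _ hk hvw) (lt_of_le_of_lt (hTle j hj i hper.1) h1)
      (h2.trans (hd γ0 ha0 hv0 hn0))
  -- going back in time
  have hback : ∀ i j, i < j → j < n → ∀ v ∈ S i, ∀ γ0, Act j γ0 → arr γ0 ≤ T i →
      Act i γ0 ∧ node γ0 ∉ S i := by
    intro i j hij hj v hv γ0 ha harr
    have hd := hActdl j hj γ0 ha
    rw [hAct] at ha
    refine ⟨(hAct _ _).2 ⟨harr, fun k hk => ha.2 k (by omega)⟩, fun hn => ?_⟩
    exact ha.2 i hij ⟨hn, harr, (hT j hj i hij).le.trans hd⟩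
  let U : Finset (ℕ × V) := Finset.range n ×ˢ (Finset.univ : Finset V)
  have hU : ∀ x, x ∈ U ↔ x.1 < n := by intro x; simp [U]
  let A : Finset (ℕ × V) := U.filter Ov
  let NB : ℕ × V → Prop := fun x => x.2 ∈ S x.1 ∧ ¬ Ov x
  let B : Finset (ℕ × V) := U.filter NB
  let Good : ℕ × V → Prop := fun x => ∃ k, x.2 ∈ O k ∧ o k ≤ T x.1 ∧
    ∀ i < x.1, x.2 ∈ S i → T i < o k
  let A0 : Finset (ℕ × V) := A.filter Good
  let A1 : Finset (ℕ × V) := A.filter (fun x => ¬ Good x)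
  let Up : ℕ × V → Prop := fun x => ∃ y, y.1 < n ∧ WfPer S y.2 x.1 y.1 ∧ NB y ∧ I x.1 x.2 y.2 ≠ 0
  let A' : Finset (ℕ × V) := A.filter Up
  let L : V → ℝ := fun v => (level par v : ℝ)
  let H : V → ℝ := fun v => (depth par : ℝ) - level par v
  have hL0 : ∀ v, 0 ≤ L v := fun v => by positivity
  have hH0 : ∀ v, 0 ≤ H v := fun v => sub_nonneg.2 (by exact_mod_cast wf_level_le par v)
  have hLlt : ∀ i < n, ∀ v w, I i v w ≠ 0 → L v + 1 ≤ L w := by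
    intro i hi v w h
    obtain ⟨h1, h2, _⟩ := hinv i hi v w h
    have := wf_level_lt r par hroot hreach h1 h2
    simp only [L]
    exact_mod_cast this
  have hL1 : ∀ v, 1 ≤ L v := by
    intro v
    have : 0 < level par v := Finset.card_pos.2 ⟨v, wf_rp_self par v⟩
    simp only [L]
    exact_mod_cast this
  have hprice := fun w j hj hw => wf_price' n c S P I hP0 (fun i hi w hw => (hcol i hi w hw).2)
    hcol' w j hj hw
  -- previous service for bad overdue pairs
  have hprev : ∀ x ∈ A1, ∃ i, i < x.1 ∧ x.2 ∈ S i ∧ (∀ k, i < k → k < x.1 → x.2 ∉ S k) ∧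
      ∑ w, I i x.2 w = c x.2 ∧ ∀ w, I i x.2 w ≠ 0 → ∃ j < n, WfPer S w i j ∧ Ov (j, w) := by
    rintro ⟨m, v⟩ hx
    simp only [A1, A, Finset.mem_filter, hU] at hx
    obtain ⟨⟨hm, hvm, γ, ha, hvγ, hno⟩, hbad⟩ := hx
    dsimp only at hm hvm ha hvγ hno ⊢
    obtain ⟨k, hk⟩ := hfeas γ
    have hvk : v ∈ O k := hOcl k _ _ hk.1 hvγ
    have hkm : o k ≤ T m := by
      by_contra h
      exact hno k hvk (not_le.1 h) hk.2.2
    have hex : ∃ i, i < m ∧ v ∈ S i := by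
      by_contra h
      push Not at h
      exact hbad ⟨k, hvk, hkm, fun i hi hvi => absurd hvi (h i hi)⟩
    let W := (Finset.range m).filter (fun i => v ∈ S i)
    have hW : W.Nonempty := by
      obtain ⟨i, hi, hvi⟩ := hex
      exact ⟨i, by simp [W, hi, hvi]⟩
    have hmem := Finset.max'_mem W hW
    set i := W.max' hW with hidef
    simp only [W, Finset.mem_filter, Finset.mem_range] at hmem
    have hmax : ∀ l, l < m → v ∈ S l → l ≤ i := by
      intro l hl hvl
      exact Finset.le_max' W l (by simp [W, hl, hvl])
    have hin : i < n := by omega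
    have hnoOPT : ∀ k, v ∈ O k → T i < o k → o k ≤ T m → False := by
      intro k hk h1 h2
      apply hbad
      refine ⟨k, hk, h2, fun l hl hvl => lt_of_le_of_lt (hTle i hin l (hmax l hl hvl)) h1⟩
    have hki : o k ≤ T i := by
      by_contra h
      exact hnoOPT k hvk (not_le.1 h) hkm
    obtain ⟨ha', hn'⟩ := hback i m hmem.1 hm v hmem.2 γ ha (hk.2.1.trans hki)
    refine ⟨i, hmem.1, hmem.2, ?_, hrow' i hin v hmem.2 γ ha' hvγ hn', ?_⟩
    · intro l hl hlm hvl
      have := hmax l hlm hvl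
      omega
    · intro w hw
      obtain ⟨_, _, γ', ha2, hwγ, _⟩ := hinv i hin v w hw
      obtain ⟨j, hj, hper⟩ := hnext i hin w γ' ha2 hwγ
      refine ⟨j, hj, hper, hX i hin v hmem.2 γ ha' hvγ hn' ?_ w hw j hj hper⟩
      intro k hk h1 h2
      by_cases h : o k ≤ T m
      · exact hnoOPT k hk h1 h
      · exact hno k hk (not_le.1 h) h2
  choose! pr hpr1 hpr2 hpr3 hpr4 hpr5 using hprev
  have hA1n : ∀ x ∈ A1, x.1 < n ∧ x.2 ∈ S x.1 := by
    intro x hx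
    simp only [A1, A, Finset.mem_filter, hU] at hx
    exact ⟨hx.1.1, hx.1.2.1⟩
  let Wt : ℕ × V → ℝ := fun z => ∑ y ∈ U,
    (if Ov y ∧ WfPer S y.2 z.1 y.1 then (L y.2 - 1) * I z.1 z.2 y.2 else 0)
  have hterm : ∀ z ∈ U, ∀ y, 0 ≤ (if Ov y ∧ WfPer S y.2 z.1 y.1 then
      (L y.2 - 1) * I z.1 z.2 y.2 else 0) := by
    intro z hz y
    split_ifs
    · exact mul_nonneg (by linarith [hL1 y.2]) (hInn _ ((hU z).1 hz) _ _)
    · exact le_rfl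
  have hdown1 : ∀ x ∈ A1, L x.2 * c x.2 ≤ Wt (pr x, x.2) := by
    intro x hx
    have hin : pr x < n := (hpr1 x hx).trans (hA1n x hx).1
    have hz : (pr x, x.2) ∈ U := (hU _).2 hin
    rw [← hpr4 x hx, Finset.mul_sum]
    simp only [Wt, U]
    rw [Finset.sum_product_right]
    apply Finset.sum_le_sum
    intro w _
    by_cases hw : I (pr x) x.2 w = 0
    · simp [hw]
    · obtain ⟨j, hj, hper, hov⟩ := hpr5 x hx w hw
      refine le_trans ?_ (Finset.single_le_sum (fun j _ => hterm _ hz (j, w))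
        (Finset.mem_range.2 hj))
      rw [if_pos ⟨hov, hper⟩]
      apply mul_le_mul_of_nonneg_right _ (hInn _ hin _ _)
      have := hLlt _ hin _ _ hw
      linarith
  have hdown2 : ∑ x ∈ A1, Wt (pr x, x.2) ≤ ∑ z ∈ U, Wt z := by
    have : ∑ x ∈ A1, Wt (pr x, x.2) = ∑ z ∈ A1.image (fun x => (pr x, x.2)), Wt z := by
      rw [Finset.sum_image]
      intro x hx y hy hxy
      simp only [Prod.mk.injEq] at hxy
      obtain ⟨h1, h2⟩ := hxy
      refine Prod.ext ?_ h2
      rcases lt_trichotomy x.1 y.1 with h | h | h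
      · exfalso
        refine hpr3 y hy x.1 ?_ h ?_
        · rw [← h1]; exact hpr1 x hx
        · rw [← h2]; exact (hA1n x hx).2
      · exact h
      · exfalso
        refine hpr3 x hx y.1 ?_ h ?_
        · rw [h1]; exact hpr1 y hy
        · rw [h2]; exact (hA1n y hy).2
    rw [this]
    apply Finset.sum_le_sum_of_subset_of_nonneg
    · intro z hz
      obtain ⟨x, hx, rfl⟩ := Finset.mem_image.1 hz
      exact (hU _).2 ((hpr1 x hx).trans (hA1n x hx).1)
    · intro z hz _
      exact Finset.sum_nonneg (fun y _ => hterm z hz y)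
  have hdown3 : ∑ z ∈ U, Wt z ≤ ∑ y ∈ A, (L y.2 - 1) * c y.2 := by
    have e : ∑ z ∈ U, Wt z = ∑ y ∈ A, (L y.2 - 1) *
        ∑ i ∈ (Finset.range n).filter (fun i => WfPer S y.2 i y.1), ∑ v, I i v y.2 := by
      convert wf_swap n S I Ov (fun w => L w - 1)
    rw [e]
    apply Finset.sum_le_sum
    intro y hy
    have hy' := Finset.mem_filter.1 hy
    have hyn := (hU y).1 hy'.1
    apply mul_le_mul_of_nonneg_left _ (by linarith [hL1 y.2])
    rw [hprice y.2 y.1 hyn hy'.2.1]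
    have := (hcol y.1 hyn y.2 hy'.2.1).1
    linarith
  have hdown : ∑ x ∈ A, c x.2 ≤ ∑ x ∈ A0, L x.2 * c x.2 := by
    have h1 : ∑ x ∈ A1, L x.2 * c x.2 ≤ ∑ y ∈ A, (L y.2 - 1) * c y.2 :=
      (Finset.sum_le_sum hdown1).trans (hdown2.trans hdown3)
    have h2 : ∑ x ∈ A0, L x.2 * c x.2 + ∑ x ∈ A1, L x.2 * c x.2 = ∑ x ∈ A, L x.2 * c x.2 :=
      Finset.sum_filter_add_sum_filter_not A Good _
    have h3 : ∑ y ∈ A, (L y.2 - 1) * c y.2 = ∑ x ∈ A, L x.2 * c x.2 - ∑ x ∈ A, c x.2 := by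
      rw [← Finset.sum_sub_distrib]
      apply Finset.sum_congr rfl
      intro x _; ring
    linarith
  -- upward charging
  have hBfull : ∀ y ∈ B, ∑ i ∈ (Finset.range n).filter (fun i => WfPer S y.2 i y.1),
      ∑ v, I i v y.2 = c y.2 := by
    intro y hy
    have hy' := Finset.mem_filter.1 hy
    have hyn := (hU y).1 hy'.1
    have hyS := hy'.2.1
    rw [hprice y.2 y.1 hyn hyS]
    obtain ⟨ρ, ha, hd, hρ⟩ := (hsteps y.1 hyn).1
    rcases hρ y.2 hyS with h | h
    · exfalso
      apply hy'.2.2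
      refine ⟨hyS, ρ, ha, h, fun k _ h1 h2 => ?_⟩
      rw [hd] at h2
      exact absurd h1 (not_lt.2 h2)
    · rw [h]; ring
  have hup1 : ∑ y ∈ B, (H y.2 + 1) * c y.2 = ∑ z ∈ U, ∑ y ∈ U,
      (if NB y ∧ WfPer S y.2 z.1 y.1 then (H y.2 + 1) * I z.1 z.2 y.2 else 0) := by
    have e : ∑ z ∈ U, ∑ y ∈ U,
        (if NB y ∧ WfPer S y.2 z.1 y.1 then (H y.2 + 1) * I z.1 z.2 y.2 else 0) =
        ∑ y ∈ B, (H y.2 + 1) *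
        ∑ i ∈ (Finset.range n).filter (fun i => WfPer S y.2 i y.1), ∑ v, I i v y.2 := by
      convert wf_swap n S I NB (fun w => H w + 1)
    rw [e]
    apply Finset.sum_congr rfl
    intro y hy
    rw [hBfull y hy]
  have hup2 : ∀ z ∈ U, ∑ y ∈ U,
      (if NB y ∧ WfPer S y.2 z.1 y.1 then (H y.2 + 1) * I z.1 z.2 y.2 else 0) ≤
      (if NB z then H z.2 * c z.2 else 0) + (if Ov z ∧ Up z then H z.2 * c z.2 else 0) := by
    intro z hz
    have hzn := (hU z).1 hz
    have hnn : 0 ≤ H z.2 * c z.2 := mul_nonneg (hH0 _) (hc _).le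
    have hbound : ∑ y ∈ U,
        (if NB y ∧ WfPer S y.2 z.1 y.1 then (H y.2 + 1) * I z.1 z.2 y.2 else 0) ≤
        H z.2 * c z.2 := by
      refine le_trans ?_ (mul_le_mul_of_nonneg_left (hrow z.1 hzn z.2) (hH0 _))
      rw [Finset.mul_sum]
      simp only [U]
      rw [Finset.sum_product_right]
      apply Finset.sum_le_sum
      intro w _
      have hnw : 0 ≤ H z.2 * I z.1 z.2 w := mul_nonneg (hH0 _) (hInn _ hzn _ _)
      by_cases hw : I z.1 z.2 w = 0
      · simp [hw]
      by_cases hex : ∃ j, WfPer S w z.1 j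
      · obtain ⟨j, hj⟩ := hex
        have : ∀ l ∈ Finset.range n, (if NB (l, w) ∧ WfPer S w z.1 l then
            (H w + 1) * I z.1 z.2 w else 0) ≤ if j = l then H z.2 * I z.1 z.2 w else 0 := by
          intro l _
          by_cases hl : WfPer S w z.1 l
          · have := wf_per_unique S w z.1 l j hl hj
            subst this
            rw [if_pos rfl]
            split_ifs
            · apply mul_le_mul_of_nonneg_right _ (hInn _ hzn _ _)
              have := hLlt _ hzn _ _ hw
              simp only [H]
              simp only [L] at this
              linarith
            · exact hnw
          · rw [if_neg (fun h => hl h.2)]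
            split_ifs
            · exact hnw
            · exact le_rfl
        refine (Finset.sum_le_sum this).trans ?_
        rw [Finset.sum_ite_eq]
        split_ifs
        · exact le_rfl
        · exact hnw
      · refine le_trans (le_of_eq ?_) hnw
        apply Finset.sum_eq_zero
        intro l _
        rw [if_neg (fun h => hex ⟨l, h.2⟩)]
    by_cases h1 : NB z
    · rw [if_pos h1]
      refine hbound.trans ?_
      split_ifs <;> linarith
    · by_cases h2 : Ov z ∧ Up z
      · rw [if_neg h1, if_pos h2]; linarith
      · rw [if_neg h1, if_neg h2, add_zero]
        apply le_of_eq
        apply Finset.sum_eq_zero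
        intro y hy
        split_ifs with h3
        · suffices I z.1 z.2 y.2 = 0 by rw [this, mul_zero]
          by_contra h4
          have hzS : z.2 ∈ S z.1 := by
            by_contra h5
            exact h4 (hI0 z.1 hzn _ _ h5)
          have hzO : Ov z := by
            by_contra h5
            exact h1 ⟨hzS, h5⟩
          exact h2 ⟨hzO, y, (hU y).1 hy, h3.2, h3.1, h4⟩
        · rfl
  have hup : ∑ x ∈ B, c x.2 ≤ ∑ x ∈ A', H x.2 * c x.2 := by
    have h1 := hup1.le.trans (Finset.sum_le_sum hup2)
    rw [Finset.sum_add_distrib, ← Finset.sum_filter, ← Finset.sum_filter] at h1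
    have hA' : A' = U.filter (fun a => Ov a ∧ Up a) := by
      simp only [A', A]
      rw [Finset.filter_filter]
    have h3 : ∑ y ∈ B, (H y.2 + 1) * c y.2 = ∑ x ∈ B, H x.2 * c x.2 + ∑ x ∈ B, c x.2 := by
      rw [← Finset.sum_add_distrib]
      apply Finset.sum_congr rfl
      intro x _; ring
    rw [h3] at h1
    have h4 : ∑ x ∈ B, H x.2 * c x.2 + ∑ x ∈ B, c x.2 ≤
      ∑ x ∈ B, H x.2 * c x.2 + ∑ x ∈ A', H x.2 * c x.2 := by rw [hA']; exact h1
    linarith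
  -- injections into OPT
  have hinj0 : ∑ x ∈ A0, L x.2 * c x.2 ≤ ∑ k, ∑ v ∈ O k, L v * c v := by
    have hg : ∀ x ∈ A0, Good x := fun x hx => (Finset.mem_filter.1 hx).2
    rcases A0.eq_empty_or_nonempty with he | ⟨x0, hx0⟩
    · rw [he, Finset.sum_empty]
      exact Finset.sum_nonneg (fun k _ => Finset.sum_nonneg
        (fun v _ => mul_nonneg (hL0 v) (hc v).le))
    have : Nonempty K := ⟨(hg x0 hx0).choose⟩
    choose! f hf1 hf2 hf3 using hg
    have hA0S : ∀ x ∈ A0, x.2 ∈ S x.1 :=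
      fun x hx => (Finset.mem_filter.1 (Finset.mem_filter.1 hx).1).2.1
    refine wf_inj O A0 f (fun v => L v * c v) (fun v => mul_nonneg (hL0 v) (hc v).le) hf1 ?_
    have key : ∀ x ∈ A0, ∀ y ∈ A0, x.2 = y.2 → f x = f y → ¬ x.1 < y.1 := by
      intro x hx y hy h1 h2 h
      have a := hf3 y hy x.1 h (by rw [← h1]; exact hA0S x hx)
      have b := hf2 x hx
      rw [h2] at b
      linarith
    intro x hx y hy h1 h2
    refine Prod.ext ?_ h1
    have a := key x hx y hy h1 h2
    have b := key y hy x hx h1.symm h2.symm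
    omega
  have hinj1 : ∑ x ∈ A', H x.2 * c x.2 ≤ ∑ k, ∑ v ∈ O k, H v * c v := by
    have hg : ∀ x ∈ A', ∃ k, x.2 ∈ O k ∧ T x.1 < o k ∧
        ∀ k', x.2 ∈ O k' → T x.1 < o k' → o k ≤ o k' := by
      intro x hx
      have hx1 := Finset.mem_filter.1 hx
      have hx2 := Finset.mem_filter.1 hx1.1
      have hxn := (hU x).1 hx2.1
      obtain ⟨y, hyn, hper, hNB, hI⟩ := hx1.2
      obtain ⟨hvw, _, γ, ha, hwγ, _⟩ := hinv x.1 hxn _ _ hI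
      have hay := hpersist x.1 y.1 hyn y.2 γ ha hwγ hper
      have hexk : ∃ k, x.2 ∈ O k ∧ T x.1 < o k := by
        by_contra hcon
        push Not at hcon
        apply hNB.2
        refine ⟨hNB.1, γ, hay, hwγ, fun k hk h1 _ => ?_⟩
        have h5 := hcon k (hOcl k _ _ hk hvw)
        have h6 := hTle y.1 hyn x.1 hper.1
        linarith
      obtain ⟨k0, hk0⟩ := hexk
      obtain ⟨k, hk, hmin⟩ := Finset.exists_min_image
        ((Finset.univ : Finset K).filter (fun k => x.2 ∈ O k ∧ T x.1 < o k)) o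
        ⟨k0, by simpa using hk0⟩
      rw [Finset.mem_filter] at hk
      exact ⟨k, hk.2.1, hk.2.2, fun k' h1 h2 => hmin k' (by simp [h1, h2])⟩
    rcases A'.eq_empty_or_nonempty with he | ⟨x0, hx0⟩
    · rw [he, Finset.sum_empty]
      exact Finset.sum_nonneg (fun k _ => Finset.sum_nonneg
        (fun v _ => mul_nonneg (hH0 v) (hc v).le))
    have : Nonempty K := ⟨(hg x0 hx0).choose⟩
    choose! f hf1 hf2 hf3 using hg
    refine wf_inj O A' f (fun v => H v * c v) (fun v => mul_nonneg (hH0 v) (hc v).le) hf1 ?_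
    have key : ∀ x ∈ A', ∀ y ∈ A', x.2 = y.2 → f x = f y → ¬ x.1 < y.1 := by
      intro x hx y hy h1 h2 h
      have hx1 := Finset.mem_filter.1 hx
      have hx2 := Finset.mem_filter.1 hx1.1
      have hxn := (hU x).1 hx2.1
      have hy1 := Finset.mem_filter.1 hy
      have hy2 := Finset.mem_filter.1 hy1.1
      have hyn := (hU y).1 hy2.1
      obtain ⟨γ0, ha0, hv0, hno⟩ := hy2.2.2
      rw [← h1] at hv0 hno
      have hfy := hf2 y hy
      rw [← h2] at hfy
      obtain ⟨k, hk⟩ := hfeas γ0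
      have hvk : x.2 ∈ O k := hOcl k _ _ hk.1 hv0
      have hkx : o k ≤ T x.1 := by
        by_contra hcon
        rw [not_le] at hcon
        have := hf3 x hx k hvk hcon
        exact hno k hvk (by linarith) hk.2.2
      obtain ⟨ha', hn'⟩ := hback x.1 y.1 h hyn x.2 hx2.2.1 γ0 ha0 (hk.2.1.trans hkx)
      obtain ⟨z, hzn, hper, hNB, hI⟩ := hx1.2
      refine hNB.2 (hX x.1 hxn x.2 hx2.2.1 γ0 ha' hv0 hn' ?_ z.2 hI z.1 hzn hper)
      intro k' hk' h3 h4
      have := hf3 x hx k' hk' h3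
      exact hno k' hk' (by linarith) h4
    intro x hx y hy h1 h2
    refine Prod.ext ?_ h1
    have a := key x hx y hy h1 h2
    have b := key y hy x hx h1.symm h2.symm
    omega
  have htot : ∑ i ∈ Finset.range n, ∑ v ∈ S i, c v = ∑ x ∈ A, c x.2 + ∑ x ∈ B, c x.2 := by
    simp only [A, B]
    rw [Finset.sum_filter, Finset.sum_filter, ← Finset.sum_add_distrib]
    simp only [U]
    rw [Finset.sum_product]
    apply Finset.sum_congr rfl
    intro i _
    rw [← Finset.univ_inter (S i), ← Finset.sum_ite_mem]
    apply Finset.sum_congr rfl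
    intro v _
    by_cases hv : v ∈ S i
    · by_cases ho : Ov (i, v)
      · have : ¬ NB (i, v) := fun h => h.2 ho
        rw [if_pos hv, if_pos ho, if_neg this, add_zero]
      · have : NB (i, v) := ⟨hv, ho⟩
        rw [if_pos hv, if_neg ho, if_pos this, zero_add]
    · have h1 : ¬ Ov (i, v) := fun h => hv h.1
      have h2 : ¬ NB (i, v) := fun h => hv h.1
      rw [if_neg hv, if_neg h1, if_neg h2, add_zero]
  have hfin : ∑ k, ∑ v ∈ O k, L v * c v + ∑ k, ∑ v ∈ O k, H v * c v =
      (depth par : ℝ) * ∑ k, ∑ v ∈ O k, c v := by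
    rw [← Finset.sum_add_distrib, Finset.mul_sum]
    apply Finset.sum_congr rfl
    intro k _
    rw [← Finset.sum_add_distrib, Finset.mul_sum]
    apply Finset.sum_congr rfl
    intro v _
    simp only [L, H]; ring
  rw [htot, ← hfin]
  linarith

end abstract_part

/-- **Theorem (main)**: Waterfall is `D`-competitive on trees of depth `D`:
its schedule costs at most `D` times the cost of every feasible schedule. -/
theorem waterfall_D_competitive
    (r : V) (par : V → V) (c : V → ℝ) (node : Req → V) (arr dl : Req → ℝ)
    (hroot : par r = r) (hreach : ∀ v : V, ∃ n : ℕ, par^[n] v = r)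
    (hc : ∀ v, 0 < c v) (harr : ∀ ρ, arr ρ ≤ dl ρ) (hdl : Function.Injective dl)
    (OPT : List (Finset V × ℝ)) (hOPT : Feasible r par node arr dl OPT) :
    scheduleCost c (waterfall par c node arr dl) ≤ (depth par : ℝ) * scheduleCost c OPT := by
  obtain ⟨n, F, P, I, hwf, ⟨h0, hsteps, hT, hd⟩, hall⟩ := wf_trace par c node arr dl hc harr hdl
  have main := wf_abstract (K := Fin OPT.length) r par c node arr dl hroot hreach hc n
    (fun i => (F i).1) (fun i => (F i).2) P I
    (fun i => WfAct node arr dl ((List.range i).map F) (F i).2)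
    (by intro i γ; simp [WfAct]) hsteps h0 hT hd hall
    (fun k => (OPT.get k).1) (fun k => (OPT.get k).2)
    (fun k => (hOPT.1 _ (List.get_mem OPT k)).2)
    (by
      intro γ
      obtain ⟨s, hs, h⟩ := hOPT.2 γ
      obtain ⟨k, rfl⟩ := List.get_of_mem hs
      exact ⟨k, h⟩)
  have e1 : scheduleCost c (waterfall par c node arr dl) =
      ∑ i ∈ Finset.range n, ∑ v ∈ (F i).1, c v := by
    rw [hwf, scheduleCost, List.map_map, Finset.sum_range, ← List.sum_ofFn]
    congr 1
    apply List.ext_get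
    · simp
    · intro k h1 h2
      simp [serviceCost]
  have e2 : scheduleCost c OPT = ∑ k : Fin OPT.length, ∑ v ∈ (OPT.get k).1, c v := by
    rw [scheduleCost, ← List.sum_ofFn]
    congr 1
    apply List.ext_get
    · simp
    · intro k h1 h2
      simp [serviceCost]
  rw [e1, e2]
  exact main
end

section
/- (Arithmetic core of the doubling Lemma) Let k ≥ 1 be a natural number and let p_1, …, p_k, s_1, …, s_k, C be real numbers such that p_i > 0 for all i, p_i > 2·p_{i−1} for all 2 ≤ i ≤ k, C > 2·p_k, and 0 ≤ s_i ≤ 2·p_i for all i. Then Σ_{i=1}^k s_i < (2 − 2^{−k})·C. -/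
lemma doubling_aux (k : ℕ) : ∀ (p s : Fin k → ℝ) (C : ℝ), (∀ i, 0 < p i) → 0 < C →
    (∀ (i : Fin k) (h : (i : ℕ) + 1 < k), 2 * p i < p ⟨(i : ℕ) + 1, h⟩) →
    (∀ i : Fin k, (i : ℕ) + 1 = k → 2 * p i < C) →
    (∀ i, s i ≤ 2 * p i) → ∑ i, s i ≤ (2 - 2 * (1 / 2 : ℝ) ^ k) * C := by
  induction k with
  | zero => intro p s C _ _ _ _ _; simp
  | succ n ih =>
    intro p s C hp hC hd hl hs
    rw [Fin.sum_univ_castSucc]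
    have h1 := ih (fun i => p i.castSucc) (fun i => s i.castSucc) (p (Fin.last n))
      (fun i => hp _) (hp _)
      (fun i h => hd i.castSucc (by simp))
      (fun i h => by
        have := hd i.castSucc (by simp)
        have e : (⟨(i.castSucc : ℕ) + 1, by simp⟩ : Fin (n+1)) = Fin.last n := by
          ext; simpa using h
        rwa [e] at this)
      (fun i => hs _)
    have h2 := hs (Fin.last n)
    have h3 := hl (Fin.last n) (by simp)
    have h4 : (1 / 2 : ℝ) ^ n ≤ 1 := pow_le_one₀ (by norm_num) (by norm_num)
    rw [pow_succ]
    nlinarith [mul_nonneg (sub_nonneg.2 h3.le) (by linarith : (0:ℝ) ≤ 2 - (1 / 2 : ℝ) ^ n)]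

/-- **Arithmetic core of the doubling Lemma**: if `p 0, …, p (k-1)` are positive reals,
each more than double the previous one, `C` exceeds `2 * p (k-1)`, and
`0 ≤ s i ≤ 2 * p i` for all `i`, then `∑ i, s i < (2 - 2^{-k}) * C`. -/
theorem doubling_sum_bound
    (k : ℕ) (hk : 1 ≤ k) (p s : Fin k → ℝ) (C : ℝ)
    (hp : ∀ i, 0 < p i)
    (hdouble : ∀ (i : Fin k) (h : (i : ℕ) + 1 < k), 2 * p i < p ⟨(i : ℕ) + 1, h⟩)
    (hC : 2 * p ⟨k - 1, by omega⟩ < C)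
    (hs : ∀ i, 0 ≤ s i ∧ s i ≤ 2 * p i) :
    ∑ i, s i < (2 - (2 : ℝ) ^ (-(k : ℤ))) * C := by
  have hC0 : 0 < C := by linarith [hp ⟨k - 1, by omega⟩]
  have h := doubling_aux k p s C hp hC0 hdouble (fun i hi => by
    have e : i = ⟨k - 1, by omega⟩ := by ext; simp; omega
    rw [e]; exact hC) (fun i => (hs i).2)
  have e : (2 : ℝ) ^ (-(k : ℤ)) = (1 / 2 : ℝ) ^ k := by simp
  rw [e]
  have h5 : 0 < (1 / 2 : ℝ) ^ k := by positivity
  nlinarith [mul_pos h5 hC0]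
end
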